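/- For every integer i with 1 ≤ i ≤ r−1, letting j be the unique integer with 1 ≤ j ≤ r−1 and a·j ≡ i (mod r), the map Φ_i is surjective if and only if the set of monomials in the G-basis B(G) of weight congruent to i modulo r is exactly {x^i, y^j}; in particular, Φ_i is surjective if and only if this set has exactly two elements. -/

import Mathlib

/-- The `G`-basis `B(G)` for the cyclic group `C_{r,a}`: monomials `x^m y^n`
(identified with pairs `(m,n) ∈ ℕ × ℕ`) that are divisible by no nonconstant
`G`-invariant monomial, where `x^p y^q` is `G`-invariant iff `r ∣ p + a*q`. -/
def BG (r a : ℕ) : Set (ℕ × ℕ) :=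
  {mn | ∀ p q : ℕ, (p, q) ≠ (0, 0) → r ∣ p + a * q → ¬(p ≤ mn.1 ∧ q ≤ mn.2)}

/-- The `L`-space `L(G)`: the monomials `x^k` and `y^k` with `0 ≤ k ≤ r-1`. -/
def LG (r : ℕ) : Set (ℕ × ℕ) :=
  {mn | (mn.2 = 0 ∧ mn.1 ≤ r - 1) ∨ (mn.1 = 0 ∧ mn.2 ≤ r - 1)}

open MvPolynomial in
/-- The `ℂ`-algebra automorphism `g` of `ℂ[x,y]` with `g x = ε • x`, `g y = ε^a • y`. -/
noncomputable def gAut (ε : ℂ) (a : ℕ) :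
    MvPolynomial (Fin 2) ℂ →ₐ[ℂ] MvPolynomial (Fin 2) ℂ :=
  aeval (fun j : Fin 2 => if j = 0 then C ε * X 0 else C (ε ^ a) * X 1)

/-- The semi-invariants of weight `i`: `S_i = {f : g f = ε^i • f}`. -/
def Sset (ε : ℂ) (a : ℕ) (i : ℤ) : Set (MvPolynomial (Fin 2) ℂ) :=
  {f | gAut ε a f = (ε ^ i) • f}

/-- Surjectivity of the multiplication map `Φ_i : S_{-(a+1)} × S_i → S_{i-(a+1)}`:
`S_{i-(a+1)}` equals the `ℂ`-linear span of the products `f * h`. -/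
def PhiSurj (ε : ℂ) (a : ℕ) (i : ℤ) : Prop :=
  Sset ε a (i - (a + 1)) =
    ↑(Submodule.span ℂ
      {p : MvPolynomial (Fin 2) ℂ |
        ∃ f ∈ Sset ε a (-(a + 1)), ∃ h ∈ Sset ε a i, p = f * h})
section SemiInvariants

open MvPolynomial

theorem gAut_monomial (ε : ℂ) (a : ℕ) (d : Fin 2 →₀ ℕ) (c : ℂ) :
    gAut ε a (monomial d c) = ε ^ (d 0 + a * d 1) • monomial d c := by
  rw [gAut, aeval_monomial, Finsupp.prod_fintype _ _ (fun _ => pow_zero _), monomial_eq,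
    Finsupp.prod_fintype _ _ (fun _ => pow_zero _)]
  simp only [Fin.prod_univ_two, algebraMap_eq, smul_eq_C_mul, mul_pow, map_pow, map_mul, pow_add,
    pow_mul, if_true, Fin.reduceEq, if_false, Fin.isValue]
  ring

theorem coeff_gAut (ε : ℂ) (a : ℕ) (f : MvPolynomial (Fin 2) ℂ) (d : Fin 2 →₀ ℕ) :
    coeff d (gAut ε a f) = ε ^ (d 0 + a * d 1) * coeff d f := by
  induction f using MvPolynomial.induction_on' with
  | monomial e c =>
    rw [gAut_monomial, coeff_smul, coeff_monomial]
    split_ifs with h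
    · rw [h, smul_eq_mul]
    · simp
  | add f g hf hg => rw [map_add, coeff_add, coeff_add, hf, hg, mul_add]

theorem IsPrimitiveRoot.pow_eq_zpow_iff {ε : ℂ} {r : ℕ} (hε : IsPrimitiveRoot ε r) (hr : r ≠ 0)
    (n : ℕ) (k : ℤ) : ε ^ n = ε ^ k ↔ (n : ℤ) ≡ k [ZMOD r] := by
  have h0 : ε ≠ 0 := hε.ne_zero hr
  rw [Int.modEq_comm, Int.modEq_iff_dvd, ← hε.zpow_eq_one_iff_dvd, zpow_sub₀ h0, zpow_natCast,
    div_eq_one_iff_eq (zpow_ne_zero _ h0)]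

/-- A polynomial is semi-invariant of weight `k` iff all its monomials have weight `k`. -/
theorem mem_Sset_iff {ε : ℂ} {r : ℕ} (hε : IsPrimitiveRoot ε r) (hr : r ≠ 0) (a : ℕ) (k : ℤ)
    (f : MvPolynomial (Fin 2) ℂ) :
    f ∈ Sset ε a k ↔ ∀ d ∈ f.support, ((d 0 + a * d 1 : ℕ) : ℤ) ≡ k [ZMOD r] := by
  rw [Sset, Set.mem_ofPred_eq, MvPolynomial.ext_iff]
  refine forall_congr' fun d => ?_
  rw [coeff_gAut, coeff_smul, smul_eq_mul, mul_eq_mul_right_iff, mem_support_iff,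
    hε.pow_eq_zpow_iff hr]
  tauto

/-- `Φ_i` is surjective iff every monomial of weight `i - (a + 1)` is divisible by one of
weight `i`. -/
theorem phiSurj_iff {ε : ℂ} {r : ℕ} (hε : IsPrimitiveRoot ε r) (hr : r ≠ 0) (a : ℕ) (i : ℤ) :
    PhiSurj ε a i ↔ ∀ m n : ℕ, ((m + a * n : ℕ) : ℤ) ≡ i - (a + 1) [ZMOD r] →
      ∃ p q : ℕ, p ≤ m ∧ q ≤ n ∧ ((p + a * q : ℕ) : ℤ) ≡ i [ZMOD r] := by
  have hS := mem_Sset_iff hε hr a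
  constructor
  · intro h m n hmn
    set d : Fin 2 →₀ ℕ := Finsupp.equivFunOnFinite.symm ![m, n] with hd
    have hd0 : d 0 = m := by simp [hd]
    have hd1 : d 1 = n := by simp [hd]
    have hmem : (monomial d (1 : ℂ)) ∈ Sset ε a (i - (a + 1)) := by
      rw [hS]
      intro e he
      rw [Finset.mem_singleton.1 (support_monomial_subset he), hd0, hd1]
      exact hmn
    have key : ∀ p ∈ Submodule.span ℂ {p : MvPolynomial (Fin 2) ℂ |
        ∃ f ∈ Sset ε a (-(a + 1)), ∃ h ∈ Sset ε a i, p = f * h},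
        ∀ d ∈ p.support, ∃ e ≤ d, ((e 0 + a * e 1 : ℕ) : ℤ) ≡ i [ZMOD r] := by
      intro p hp
      induction hp using Submodule.span_induction with
      | mem p hp =>
        obtain ⟨f, -, g, hg, rfl⟩ := hp
        intro d hd
        obtain ⟨u, -, v, hv, rfl⟩ := Finset.mem_add.1 (support_mul f g hd)
        exact ⟨v, le_add_self, (hS i g).1 hg v hv⟩
      | zero => simp
      | add p q _ _ hp hq =>
        intro d hd
        rcases Finset.mem_union.1 (support_add hd) with hd | hd
        exacts [hp d hd, hq d hd]
      | smul c p _ hp => exact fun d hd => hp d (support_smul hd)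
    rw [h] at hmem
    obtain ⟨e, hed, he⟩ := key _ hmem d (by simp [mem_support_iff])
    exact ⟨e 0, e 1, hd0 ▸ hed 0, hd1 ▸ hed 1, he⟩
  · intro h
    refine Set.Subset.antisymm (fun f hf => ?_) (fun f hf => ?_)
    · rw [SetLike.mem_coe, f.as_sum]
      refine Submodule.sum_mem _ fun d hd => Submodule.subset_span ?_
      have hdw := (hS _ f).1 hf d hd
      obtain ⟨p, q, hp, hq, hpq⟩ := h (d 0) (d 1) hdw
      set e : Fin 2 →₀ ℕ := Finsupp.equivFunOnFinite.symm ![p, q] with he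
      have he0 : e 0 = p := by simp [he]
      have he1 : e 1 = q := by simp [he]
      have hed : e ≤ d := by
        intro k
        fin_cases k
        exacts [he0.trans_le hp, he1.trans_le hq]
      refine ⟨monomial (d - e) (coeff d f), ?_, monomial e 1, ?_, ?_⟩
      · rw [hS]
        intro u hu
        rw [Finset.mem_singleton.1 (support_monomial_subset hu)]
        rw [Finsupp.tsub_apply, Finsupp.tsub_apply, he0, he1]
        have := hdw.sub hpq
        push_cast [hp, hq] at this ⊢
        ring_nf at this ⊢
        exact this
      · rw [hS]
        intro u hu
        rw [Finset.mem_singleton.1 (support_monomial_subset hu), he0, he1]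
        exact hpq
      · rw [monomial_mul, tsub_add_cancel_of_le hed, mul_one]
    · induction hf using Submodule.span_induction with
      | mem p hp =>
        obtain ⟨f, hf, g, hg, rfl⟩ := hp
        rw [Sset, Set.mem_ofPred_eq] at *
        rw [map_mul, hf, hg, smul_mul_smul_comm, ← zpow_add₀ (hε.ne_zero hr)]
        congr 2
        ring
      | zero => simp [Sset]
      | add p q _ _ hp hq =>
        rw [Sset, Set.mem_ofPred_eq] at *
        rw [map_add, hp, hq, smul_add]
      | smul c p _ hp =>
        rw [Sset, Set.mem_ofPred_eq] at *
        rw [map_smul, hp, smul_comm]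

end SemiInvariants

/-- The `G`-basis generates the semi-invariant monomials over the invariant ones. -/
theorem exists_mem_BG_le (r a m n : ℕ) :
    ∃ u ∈ BG r a, u.1 ≤ m ∧ u.2 ≤ n ∧ r ∣ (m - u.1) + a * (n - u.2) := by
  induction hs : m + n using Nat.strong_induction_on generalizing m n with
  | _ s ih =>
  by_cases hB : (m, n) ∈ BG r a
  · exact ⟨(m, n), hB, le_rfl, le_rfl, by simp⟩
  · simp only [BG, Set.mem_ofPred_eq, not_forall, not_not] at hB
    obtain ⟨p, q, hpq, hdvd, hp, hq⟩ := hB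
    have hpos : 0 < p + q := by
      by_contra! h0
      exact hpq (Prod.ext (by simp; omega) (by simp; omega))
    obtain ⟨u, hu, hu1, hu2, hur⟩ := ih (m - p + (n - q)) (by omega) (m - p) (n - q) rfl
    refine ⟨u, hu, by omega, by omega, ?_⟩
    have h1 : m - u.1 = (m - p - u.1) + p := by omega
    have h2 : n - u.2 = (n - q - u.2) + q := by omega
    have h3 := dvd_add hur hdvd
    rw [h1, h2]
    ring_nf at h3 ⊢
    exact h3

theorem fst_lt_of_mem_BG {r a : ℕ} (hr : r ≠ 0) {u : ℕ × ℕ} (hu : u ∈ BG r a) : u.1 < r := by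
  by_contra! h
  exact hu r 0 (by simp [hr]) (by simp) ⟨h, Nat.zero_le _⟩

theorem snd_lt_of_mem_BG {r a : ℕ} (hr : r ≠ 0) {u : ℕ × ℕ} (hu : u ∈ BG r a) : u.2 < r := by
  by_contra! h
  exact hu 0 r (by simp [hr]) (by simp) ⟨Nat.zero_le _, h⟩

theorem mk_zero_mem_BG {r a m : ℕ} (hm : m < r) : (m, 0) ∈ BG r a := by
  rintro p q h0 hdvd ⟨hp, hq⟩
  obtain rfl : q = 0 := by simpa using hq
  have := Nat.eq_zero_of_dvd_of_lt (by simpa using hdvd) (lt_of_le_of_lt hp hm)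
  simp [this] at h0

theorem zero_mk_mem_BG {r a n : ℕ} (h : Nat.Coprime a r) (hn : n < r) : (0, n) ∈ BG r a := by
  rintro p q h0 hdvd ⟨hp, hq⟩
  obtain rfl : p = 0 := by simpa using hp
  have := Nat.eq_zero_of_dvd_of_lt (h.symm.dvd_of_dvd_mul_left (by simpa using hdvd))
    (lt_of_le_of_lt hq hn)
  simp [this] at h0

theorem phiSurj_iff_BG_eq {r a : ℕ} (hgcd : Nat.Coprime a r) {ε : ℂ} (hε : IsPrimitiveRoot ε r)
    {i j : ℕ} (hi : i < r) (hj : j < r) (hij : a * j ≡ i [MOD r]) :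
    PhiSurj ε a (i : ℤ) ↔
      {mn ∈ BG r a | ((mn.1 + a * mn.2 : ℕ) : ℤ) ≡ (i : ℤ) [ZMOD r]} = {(i, 0), (0, j)} := by
  have hr : r ≠ 0 := by omega
  rw [phiSurj_iff hε hr]
  constructor
  · intro h
    ext ⟨m, n⟩
    simp only [Set.mem_ofPred_eq, Set.mem_insert_iff, Set.mem_singleton_iff]
    constructor
    · rintro ⟨hB, hw⟩
      have hm := fst_lt_of_mem_BG hr hB
      have hn := snd_lt_of_mem_BG hr hB
      rcases Nat.eq_zero_or_pos n with rfl | hn0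
      · left
        have : m ≡ i [MOD r] := by simpa [Int.natCast_modEq_iff] using hw
        rw [this.eq_of_lt_of_lt hm hi]
      rcases Nat.eq_zero_or_pos m with rfl | hm0
      · right
        have : a * n ≡ i [MOD r] := by
          rw [← Int.natCast_modEq_iff]; simpa using hw
        have := Nat.ModEq.cancel_left_of_coprime hgcd.symm (this.trans hij.symm)
        rw [this.eq_of_lt_of_lt hn hj]
      obtain ⟨m, rfl⟩ := Nat.exists_eq_add_of_lt hm0
      obtain ⟨n, rfl⟩ := Nat.exists_eq_add_of_lt hn0
      simp only [zero_add] at *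
      obtain ⟨p, q, hp, hq, hpq⟩ := h m n (by
        have := hw.sub_right (a + 1 : ℤ)
        push_cast at this ⊢
        ring_nf at this ⊢
        exact this)
      refine absurd ⟨Nat.sub_le _ p, Nat.sub_le _ q⟩
        (hB (m + 1 - p) (n + 1 - q) (by simp; omega) ?_)
      have := hpq.trans hw.symm
      rw [Int.modEq_iff_dvd] at this
      rw [← Int.natCast_dvd_natCast]
      convert this using 1
      push_cast [(by omega : p ≤ m + 1), (by omega : q ≤ n + 1)]
      ring
    · rintro (h | h) <;> obtain ⟨rfl, rfl⟩ := Prod.mk.inj h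
      · exact ⟨mk_zero_mem_BG hi, by simp⟩
      · refine ⟨zero_mk_mem_BG hgcd hj, ?_⟩
        rw [Int.natCast_modEq_iff]; simpa using hij
  · intro h m n hmn
    obtain ⟨u, hu, hu1, hu2, hdvd⟩ := exists_mem_BG_le r a (m + 1) (n + 1)
    have hxi : ((i + a * 0 : ℕ) : ℤ) ≡ (i : ℤ) [ZMOD r] := by simp
    have hyj : ((0 + a * j : ℕ) : ℤ) ≡ (i : ℤ) [ZMOD r] := by
      rw [Int.natCast_modEq_iff]; simpa using hij
    have huw : u ∈ {mn ∈ BG r a | ((mn.1 + a * mn.2 : ℕ) : ℤ) ≡ (i : ℤ) [ZMOD r]} := by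
      refine ⟨hu, Int.ModEq.trans ?_ (b := ((m + 1 + a * (n + 1) : ℕ) : ℤ)) ?_⟩
      · rw [Int.modEq_iff_dvd]
        rw [← Int.natCast_dvd_natCast] at hdvd
        convert hdvd using 1
        push_cast [hu1, hu2]
        ring
      · have := hmn.add_right (a + 1 : ℤ)
        push_cast at this ⊢
        ring_nf at this ⊢
        exact this
    by_cases hmi : i ≤ m
    · exact ⟨i, 0, hmi, Nat.zero_le _, hxi⟩
    by_cases hnj : j ≤ n
    · exact ⟨0, j, Nat.zero_le _, hnj, hyj⟩
    rw [h] at huw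
    rcases huw with rfl | rfl
    · obtain rfl : i = m + 1 := by simp only at hu1; omega
      have hrn : r ∣ n + 1 := hgcd.symm.dvd_of_dvd_mul_left (by simpa using hdvd)
      have := Nat.le_of_dvd (Nat.succ_pos n) hrn
      omega
    · obtain rfl : j = n + 1 := by simp only at hu2; omega
      have hrm : r ∣ m + 1 := by simpa using hdvd
      have := Nat.le_of_dvd (Nat.succ_pos m) hrm
      omega

/-- for `1 ≤ i ≤ r-1` and `j` the unique integer with `1 ≤ j ≤ r-1` and
`a·j ≡ i (mod r)`, the map `Φ_i` is surjective iff the set of monomials in `B(G)` of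
weight `≡ i (mod r)` is exactly `{x^i, y^j}`; in particular iff that set has exactly
two elements. -/
theorem stmt_10 (r a : ℕ) (hr : 2 ≤ r) (ha1 : 1 ≤ a) (ha2 : a ≤ r - 1)
    (hgcd : Nat.Coprime a r) (ε : ℂ) (hε : IsPrimitiveRoot ε r)
    (i : ℕ) (hi1 : 1 ≤ i) (hi2 : i ≤ r - 1)
    (j : ℕ) (hj1 : 1 ≤ j) (hj2 : j ≤ r - 1) (hj : Nat.ModEq r (a * j) i) :
    (PhiSurj ε a (i : ℤ) ↔
        {mn ∈ BG r a | Int.ModEq (r : ℤ) ((mn.1 + a * mn.2 : ℕ) : ℤ) (i : ℤ)} =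
          {(i, 0), (0, j)}) ∧
      (PhiSurj ε a (i : ℤ) ↔
        Set.ncard
          {mn ∈ BG r a | Int.ModEq (r : ℤ) ((mn.1 + a * mn.2 : ℕ) : ℤ) (i : ℤ)}
          = 2) := by
  have hmain := phiSurj_iff_BG_eq hgcd hε (by omega : i < r) (by omega : j < r) hj
  refine ⟨hmain, hmain.trans ⟨fun h => ?_, fun h => ?_⟩⟩
  · rw [h, Set.ncard_pair (by simp; omega)]
  · refine (Set.eq_of_subset_of_ncard_le ?_ ?_ (Set.finite_of_ncard_ne_zero (by omega))).symm
    · rintro u (rfl | rfl)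
      · exact ⟨mk_zero_mem_BG (by omega), by simp⟩
      · refine ⟨zero_mk_mem_BG hgcd (by omega), ?_⟩
        rw [Int.natCast_modEq_iff]; simpa using hj
    · rw [h, Set.ncard_pair (by simp; omega)]
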